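/- The minimax risk of missing mass estimation satisfies 1/4 ≤ liminf_{n→∞} n·R*_n and limsup_{n→∞} n·R*_n ≤ 1/4 + e^{−1}. -/

import Mathlib

open scoped BigOperators

noncomputable section

/-- `p` is a probability mass function on `ℕ`. -/
def IsPMF (p : ℕ → ℝ) : Prop := (∀ u, 0 ≤ p u) ∧ HasSum p 1

/-- `N_u(X^n)`: the number of appearances of the symbol `u` in the sample `x`. -/
def nOcc {n : ℕ} (x : Fin n → ℕ) (u : ℕ) : ℕ :=
  (Finset.univ.filter fun i => x i = u).card

/-- Probability of the sample `x` under the `n`-fold product measure `p^⊗n`. -/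
def sampleProb {n : ℕ} (p : ℕ → ℝ) (x : Fin n → ℕ) : ℝ := ∏ i, p (x i)

/-- Expectation of `f(X^n)` for `X^n ∼ p^⊗n`. -/
def expct (n : ℕ) (p : ℕ → ℝ) (f : (Fin n → ℕ) → ℝ) : ℝ :=
  ∑' x : Fin n → ℕ, sampleProb p x * f x

/-- The missing mass `M₀(X^n) = ∑_u p(u) 𝟙[N_u(X^n) = 0]`. -/
def missingMass {n : ℕ} (p : ℕ → ℝ) (x : Fin n → ℕ) : ℝ :=
  ∑' u : ℕ, if nOcc x u = 0 then p u else 0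

/-- `Φ_i(X^n)`: the number of symbols appearing exactly `i` times in `x` (for `i ≥ 1`). -/
def phi {n : ℕ} (i : ℕ) (x : Fin n → ℕ) : ℕ :=
  ((Finset.univ.image x).filter fun u => nOcc x u = i).card

/-- The Good-Turing estimator `M^GT(X^n) = Φ₁(X^n)/n`. -/
def goodTuring {n : ℕ} (x : Fin n → ℕ) : ℝ := (phi 1 x : ℝ) / n

/-- The squared-error risk `R_n(M̂, p) = E[(M̂(X^n) - M₀(X^n))²]`. -/
def risk (n : ℕ) (p : ℕ → ℝ) (M : (Fin n → ℕ) → ℝ) : ℝ :=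
  expct n p fun x => (M x - missingMass p x) ^ 2

/-- The worst-case risk of the Good-Turing estimator, `sup_p R_n(M^GT, p)`. -/
def gtWorstRisk (n : ℕ) : ℝ :=
  sSup {r : ℝ | ∃ p : ℕ → ℝ, IsPMF p ∧ r = risk n p goodTuring}

/-- The minimax risk `R*_n = inf_{M̂} sup_p R_n(M̂, p)`, the infimum over all
estimators `M̂ : ℕ^n → [0,1]` of the worst-case risk over all pmfs `p` on `ℕ`. -/
def minimaxRisk (n : ℕ) : ℝ :=
  sInf {r : ℝ | ∃ M : (Fin n → ℕ) → ℝ, (∀ x, M x ∈ Set.Icc (0 : ℝ) 1) ∧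
    r = sSup {s : ℝ | ∃ p : ℕ → ℝ, IsPMF p ∧ s = risk n p M}}

theorem sampleProb_nonneg {n : ℕ} {p : ℕ → ℝ} (hp : IsPMF p) (x : Fin n → ℕ) :
    0 ≤ sampleProb p x :=
  Finset.prod_nonneg fun _ _ => hp.1 _

theorem sampleProb_cons {n : ℕ} (p : ℕ → ℝ) (a : ℕ) (x : Fin n → ℕ) :
    sampleProb p (Fin.cons a x : Fin (n + 1) → ℕ) = p a * sampleProb p x := by
  simp [sampleProb, Fin.prod_univ_succ]

theorem nOcc_cons {n : ℕ} (a : ℕ) (x : Fin n → ℕ) (u : ℕ) :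
    nOcc (Fin.cons a x : Fin (n + 1) → ℕ) u = nOcc x u + if a = u then 1 else 0 := by
  simp only [nOcc, Finset.card_filter, Fin.sum_univ_succ, Fin.cons_zero, Fin.cons_succ]
  ring

theorem nOcc_le {n : ℕ} (x : Fin n → ℕ) (u : ℕ) : nOcc x u ≤ n := by
  simpa [nOcc] using Finset.card_filter_le (Finset.univ : Finset (Fin n)) fun i => x i = u

theorem hasSum_sampleProb {p : ℕ → ℝ} (hp : IsPMF p) (n : ℕ) :
    HasSum (sampleProb p : (Fin n → ℕ) → ℝ) 1 := by
  induction n with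
  | zero =>
    have h := hasSum_unique (sampleProb p : (Fin 0 → ℕ) → ℝ)
    simpa [sampleProb] using h
  | succ n ih =>
    have h := hp.2.mul ih (hp.2.summable.mul_of_nonneg ih.summable hp.1 (sampleProb_nonneg hp))
    rw [← (Fin.consEquiv fun _ : Fin (n + 1) => ℕ).hasSum_iff]
    simp only [mul_one] at h
    exact h.congr_fun fun y => sampleProb_cons p y.1 y.2

theorem summable_sampleProb_mul {n : ℕ} {p : ℕ → ℝ} (hp : IsPMF p) {f : (Fin n → ℕ) → ℝ} {C : ℝ}
    (hf : ∀ x, |f x| ≤ C) : Summable fun x => sampleProb p x * f x := by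
  refine Summable.of_norm_bounded ((hasSum_sampleProb hp n).summable.mul_right C) fun x => ?_
  rw [Real.norm_eq_abs, abs_mul, abs_of_nonneg (sampleProb_nonneg hp x)]
  exact mul_le_mul_of_nonneg_left (hf x) (sampleProb_nonneg hp x)

theorem expct_mono {n : ℕ} {p : ℕ → ℝ} (hp : IsPMF p) {f g : (Fin n → ℕ) → ℝ} {C D : ℝ}
    (hf : ∀ x, |f x| ≤ C) (hg : ∀ x, |g x| ≤ D) (h : ∀ x, f x ≤ g x) :
    expct n p f ≤ expct n p g :=
  (summable_sampleProb_mul hp hf).tsum_le_tsum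
    (fun x => mul_le_mul_of_nonneg_left (h x) (sampleProb_nonneg hp x))
    (summable_sampleProb_mul hp hg)

theorem expct_succ {n : ℕ} {p : ℕ → ℝ} (hp : IsPMF p) {f : (Fin (n + 1) → ℕ) → ℝ} {C : ℝ}
    (hf : ∀ x, |f x| ≤ C) :
    expct (n + 1) p f = ∑' a, p a * expct n p fun x => f (Fin.cons a x) := by
  have hs := summable_sampleProb_mul hp hf
  rw [expct, ← (Fin.consEquiv fun _ : Fin (n + 1) => ℕ).tsum_eq]
  rw [← (Fin.consEquiv fun _ : Fin (n + 1) => ℕ).summable_iff] at hs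
  have h := hs.tsum_prod
  refine h.trans (tsum_congr fun a => ?_)
  rw [expct, ← tsum_mul_left]
  refine tsum_congr fun x => ?_
  simp only [Function.comp, Fin.consEquiv, Equiv.coe_fn_mk, sampleProb_cons]
  ring

theorem abs_comp_nOcc_le {n : ℕ} (φ : ℕ → ℕ → ℝ) (u v : ℕ) (x : Fin n → ℕ) :
    |φ (nOcc x u) (nOcc x v)| ≤
      ∑ i ∈ Finset.range (n + 1), ∑ j ∈ Finset.range (n + 1), |φ i j| := by
  have hu : nOcc x u ∈ Finset.range (n + 1) := Finset.mem_range.2 (Nat.lt_succ_of_le (nOcc_le x u))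
  have hv : nOcc x v ∈ Finset.range (n + 1) := Finset.mem_range.2 (Nat.lt_succ_of_le (nOcc_le x v))
  refine (Finset.single_le_sum (f := fun j => |φ (nOcc x u) j|) (fun _ _ => abs_nonneg _) hv).trans ?_
  exact Finset.single_le_sum (f := fun i => ∑ j ∈ Finset.range (n + 1), |φ i j|)
    (fun _ _ => Finset.sum_nonneg fun _ _ => abs_nonneg _) hu

theorem expct_occ_succ {n : ℕ} {p : ℕ → ℝ} (hp : IsPMF p) {u v : ℕ} (huv : u ≠ v)
    (φ : ℕ → ℕ → ℝ) :
    expct (n + 1) p (fun x => φ (nOcc x u) (nOcc x v)) =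
      p u * expct n p (fun x => φ (nOcc x u + 1) (nOcc x v)) +
      p v * expct n p (fun x => φ (nOcc x u) (nOcc x v + 1)) +
      (1 - p u - p v) * expct n p (fun x => φ (nOcc x u) (nOcc x v)) := by
  rw [expct_succ hp (abs_comp_nOcc_le φ u v)]
  set g₁ := expct n p (fun x => φ (nOcc x u + 1) (nOcc x v))
  set g₂ := expct n p (fun x => φ (nOcc x u) (nOcc x v + 1))
  set g₀ := expct n p (fun x => φ (nOcc x u) (nOcc x v))
  have h := ((hp.2.mul_right g₀).add (hasSum_ite_eq u (p u * (g₁ - g₀)))).add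
    (hasSum_ite_eq v (p v * (g₂ - g₀)))
  refine (HasSum.tsum_eq (?_ : HasSum _ _)).trans
    (?_ : 1 * g₀ + p u * (g₁ - g₀) + p v * (g₂ - g₀) = _)
  · refine h.congr_fun fun a => ?_
    simp only [nOcc_cons]
    by_cases hau : a = u
    · subst hau
      simp only [↓reduceIte, if_neg huv, add_zero]
      change p a * g₁ = _
      ring
    · by_cases hav : a = v
      · subst hav
        simp only [↓reduceIte, if_neg hau, add_zero]
        change p a * g₂ = _
        ring
      · simp only [if_neg hau, if_neg hav, add_zero]
        rfl
  · ring

theorem expct_occ_single_succ {n : ℕ} {p : ℕ → ℝ} (hp : IsPMF p) (u : ℕ) (ψ : ℕ → ℝ) :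
    expct (n + 1) p (fun x => ψ (nOcc x u)) =
      p u * expct n p (fun x => ψ (nOcc x u + 1)) +
      (1 - p u) * expct n p (fun x => ψ (nOcc x u)) := by
  rw [expct_occ_succ hp (Nat.succ_ne_self u).symm fun i _ => ψ i]
  ring

theorem expct_zero (p : ℕ → ℝ) (f : (Fin 0 → ℕ) → ℝ) : expct 0 p f = f default := by
  rw [expct, tsum_eq_single default fun x hx => (hx (Subsingleton.elim x default)).elim]
  simp [sampleProb]

theorem nOcc_of_fin_zero (x : Fin 0 → ℕ) (u : ℕ) : nOcc x u = 0 := by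
  simp [nOcc]

/-- The joint law of `(N_u, N_v)` on `{0, 1}²`. -/
theorem expct_occ_pair {p : ℕ → ℝ} (hp : IsPMF p) {u v : ℕ} (huv : u ≠ v) (n : ℕ)
    (φ : ℕ → ℕ → ℝ) (hφ₁ : ∀ i j, φ (i + 2) j = 0) (hφ₂ : ∀ i j, φ i (j + 2) = 0) :
    expct n p (fun x => φ (nOcc x u) (nOcc x v)) =
      φ 0 0 * (1 - p u - p v) ^ n +
      n * p u * φ 1 0 * (1 - p u - p v) ^ (n - 1) +
      n * p v * φ 0 1 * (1 - p u - p v) ^ (n - 1) +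
      n * (n - 1) * p u * p v * φ 1 1 * (1 - p u - p v) ^ (n - 2) := by
  induction n generalizing φ with
  | zero => simp [expct_zero, nOcc_of_fin_zero]
  | succ n ih =>
    rw [expct_occ_succ hp huv, ih φ hφ₁ hφ₂,
      ih (fun i j => φ (i + 1) j) (fun i j => hφ₁ (i + 1) j) (fun i j => hφ₂ (i + 1) j),
      ih (fun i j => φ i (j + 1)) (fun i j => hφ₁ i (j + 1)) (fun i j => hφ₂ i (j + 1))]
    simp only [zero_add, one_add_one_eq_two]
    have h20 : ∀ j, φ 2 j = 0 := hφ₁ 0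
    have h02 : ∀ i, φ i 2 = 0 := fun i => hφ₂ i 0
    rw [h20, h20, h02, h02]
    rcases n with _ | _ | n
    · simp
      ring
    · simp
      ring
    · simp only [Nat.add_sub_cancel, Nat.cast_add, Nat.cast_one, show n + 1 + 1 - 2 = n by omega,
        show n + 1 + 1 + 1 - 2 = n + 1 by omega]
      ring

theorem expct_occ_single {p : ℕ → ℝ} (hp : IsPMF p) (u n : ℕ)
    (ψ : ℕ → ℝ) (hψ : ∀ i, ψ (i + 2) = 0) :
    expct n p (fun x => ψ (nOcc x u)) =
      ψ 0 * (1 - p u) ^ n + n * p u * ψ 1 * (1 - p u) ^ (n - 1) := by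
  induction n generalizing ψ with
  | zero => simp [expct_zero, nOcc_of_fin_zero]
  | succ n ih =>
    rw [expct_occ_single_succ hp, ih ψ hψ, ih (fun i => ψ (i + 1)) fun i => hψ (i + 1)]
    have h2 : ψ 2 = 0 := hψ 0
    rcases n with _ | n
    · simp
      ring
    · simp only [zero_add, one_add_one_eq_two, h2, Nat.add_sub_cancel, Nat.cast_add, Nat.cast_one]
      ring

theorem expct_occ_sub_sq {p : ℕ → ℝ} (hp : IsPMF p) (u n : ℕ) (c : ℝ) :
    expct n p (fun x => ((nOcc x u : ℝ) - c) ^ 2) =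
      n * (p u * (1 - p u)) + (n * p u - c) ^ 2 := by
  induction n generalizing c with
  | zero => simp [expct_zero, nOcc_of_fin_zero]
  | succ n ih =>
    rw [expct_occ_single_succ hp u fun i => ((i : ℝ) - c) ^ 2, ih c]
    have h := ih (c - 1)
    simp only [Nat.cast_add, Nat.cast_one]
    simp only [← sub_add, sub_add_eq_add_sub] at h ⊢
    rw [h]
    ring

theorem expct_nonneg {n : ℕ} {p : ℕ → ℝ} (hp : IsPMF p) {f : (Fin n → ℕ) → ℝ}
    (h : ∀ x, 0 ≤ f x) : 0 ≤ expct n p f :=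
  tsum_nonneg fun x => mul_nonneg (sampleProb_nonneg hp x) (h x)

theorem expct_const {p : ℕ → ℝ} (hp : IsPMF p) (n : ℕ) (c : ℝ) :
    expct n p (fun _ => c) = c := by
  rw [expct, tsum_mul_right, (hasSum_sampleProb hp n).tsum_eq, one_mul]

theorem summable_missingMass {n : ℕ} {p : ℕ → ℝ} (hp : IsPMF p) (x : Fin n → ℕ) :
    Summable fun u => if nOcc x u = 0 then p u else 0 := by
  refine Summable.of_nonneg_of_le (fun u => ?_) (fun u => ?_) hp.2.summable
  · split_ifs
    exacts [hp.1 u, le_rfl]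
  · split_ifs
    exacts [le_rfl, hp.1 u]

theorem missingMass_mem_Icc {n : ℕ} {p : ℕ → ℝ} (hp : IsPMF p) (x : Fin n → ℕ) :
    missingMass p x ∈ Set.Icc (0 : ℝ) 1 := by
  constructor
  · refine tsum_nonneg fun u => ?_
    split_ifs
    exacts [hp.1 u, le_rfl]
  · rw [missingMass, ← hp.2.tsum_eq]
    refine (summable_missingMass hp x).tsum_le_tsum (fun u => ?_) hp.2.summable
    split_ifs
    exacts [le_rfl, hp.1 u]

theorem sq_sub_le_one {a b : ℝ} (ha : a ∈ Set.Icc (0 : ℝ) 1) (hb : b ∈ Set.Icc (0 : ℝ) 1) :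
    (a - b) ^ 2 ≤ 1 := by
  obtain ⟨h1, h2⟩ := ha
  obtain ⟨h3, h4⟩ := hb
  rw [sq_le_one_iff_abs_le_one, abs_le]
  constructor <;> linarith

theorem risk_nonneg {n : ℕ} {p : ℕ → ℝ} (hp : IsPMF p) (M : (Fin n → ℕ) → ℝ) :
    0 ≤ risk n p M :=
  expct_nonneg hp fun _ => sq_nonneg _

theorem risk_le_one {n : ℕ} {p : ℕ → ℝ} (hp : IsPMF p) {M : (Fin n → ℕ) → ℝ}
    (hM : ∀ x, M x ∈ Set.Icc (0 : ℝ) 1) : risk n p M ≤ 1 := by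
  have h : ∀ x, (M x - missingMass p x) ^ 2 ≤ 1 := fun x =>
    sq_sub_le_one (hM x) (missingMass_mem_Icc hp x)
  rw [← expct_const hp n 1]
  refine expct_mono hp (C := 1) (D := 1) (fun x => ?_) (fun x => by simp) h
  rw [abs_of_nonneg (sq_nonneg _)]
  exact h x

theorem bddAbove_risk {n : ℕ} {M : (Fin n → ℕ) → ℝ} (hM : ∀ x, M x ∈ Set.Icc (0 : ℝ) 1) :
    BddAbove {s : ℝ | ∃ p : ℕ → ℝ, IsPMF p ∧ s = risk n p M} := by
  refine ⟨1, ?_⟩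
  rintro _ ⟨p, hp, rfl⟩
  exact risk_le_one hp hM

theorem minimaxRisk_nonneg (n : ℕ) : 0 ≤ minimaxRisk n := by
  refine Real.sInf_nonneg ?_
  rintro _ ⟨M, -, rfl⟩
  refine Real.sSup_nonneg ?_
  rintro _ ⟨p, hp, rfl⟩
  exact risk_nonneg hp M

theorem minimaxRisk_le {n : ℕ} {M : (Fin n → ℕ) → ℝ} (hM : ∀ x, M x ∈ Set.Icc (0 : ℝ) 1)
    {B : ℝ} (hB : ∀ p, IsPMF p → risk n p M ≤ B) (hB0 : 0 ≤ B) : minimaxRisk n ≤ B := by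
  refine LE.le.trans (csInf_le ⟨0, ?_⟩ ⟨M, hM, rfl⟩) (Real.sSup_le ?_ hB0)
  · rintro _ ⟨M, -, rfl⟩
    refine Real.sSup_nonneg ?_
    rintro _ ⟨p, hp, rfl⟩
    exact risk_nonneg hp M
  · rintro _ ⟨p, hp, rfl⟩
    exact hB p hp

theorem le_minimaxRisk {n : ℕ} {B : ℝ}
    (hB : ∀ M : (Fin n → ℕ) → ℝ, (∀ x, M x ∈ Set.Icc (0 : ℝ) 1) → ∀ S : ℝ,
      (∀ p, IsPMF p → risk n p M ≤ S) → B ≤ S) : B ≤ minimaxRisk n := by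
  refine le_csInf ⟨_, 0, by simp, rfl⟩ ?_
  rintro _ ⟨M, hM, rfl⟩
  exact hB M hM _ fun p hp => le_csSup (bddAbove_risk hM) ⟨p, hp, rfl⟩

theorem mul_one_sub_pow_le {x : ℝ} (h0 : 0 ≤ x) (h1 : x ≤ 1) (m : ℕ) :
    (m + 1) * (x * (1 - x) ^ m) ≤ 1 := by
  have hy : 0 ≤ 1 - x := sub_nonneg.2 h1
  have key : (m + 1) * (x * (1 - x) ^ m) ≤ 1 - (1 - x) ^ (m + 1) := by
    induction m with
    | zero => simp
    | succ m ih =>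
      have h2 := mul_le_mul_of_nonneg_left ih hy
      have h3 : x * (1 - x) ^ (m + 1) ≤ x :=
        mul_le_of_le_one_right h0 (pow_le_one₀ hy (by linarith))
      push_cast
      rw [pow_succ (1 - x) (m + 1)]
      rw [pow_succ] at h2 h3 ⊢
      linarith
  exact key.trans (sub_le_self _ (pow_nonneg hy _))

theorem one_sub_pow_le_exp {x : ℝ} (h1 : x ≤ 1) (m : ℕ) :
    (1 - x) ^ m ≤ Real.exp (-(m * x)) := by
  have h := pow_le_pow_left₀ (sub_nonneg.2 h1) (Real.one_sub_le_exp_neg x) m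
  rwa [← Real.exp_nat_mul, mul_neg] at h

theorem sq_mul_one_sub_pow_le {x : ℝ} (h0 : 0 ≤ x) (h1 : x ≤ 1) (m : ℕ) :
    (m : ℝ) ^ 2 * (x ^ 2 * (1 - x) ^ m) ≤ 2 := by
  have h := Real.quadratic_le_exp_of_nonneg (mul_nonneg (Nat.cast_nonneg m) h0)
  have hmx : 0 ≤ (m : ℝ) * x := mul_nonneg (Nat.cast_nonneg m) h0
  calc (m : ℝ) ^ 2 * (x ^ 2 * (1 - x) ^ m) = (m * x) ^ 2 * (1 - x) ^ m := by ring
    _ ≤ (2 * Real.exp (m * x)) * Real.exp (-(m * x)) :=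
        mul_le_mul (by linarith) (one_sub_pow_le_exp h1 m) (pow_nonneg (sub_nonneg.2 h1) _)
          (by positivity)
    _ = 2 := by rw [mul_assoc, ← Real.exp_add]; simp

theorem mul_mul_one_sub_pow_le_exp {x : ℝ} (h0 : 0 ≤ x) (h1 : x ≤ 1) (m : ℕ) :
    m * x * (1 - x) ^ m ≤ Real.exp (-1) := by
  have h := Real.add_one_le_exp (m * x - 1)
  have hmx : 0 ≤ (m : ℝ) * x := mul_nonneg (Nat.cast_nonneg m) h0
  calc m * x * (1 - x) ^ m ≤ Real.exp (m * x - 1) * Real.exp (-(m * x)) :=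
        mul_le_mul (by linarith) (one_sub_pow_le_exp h1 m) (pow_nonneg (sub_nonneg.2 h1) _)
          (Real.exp_nonneg _)
    _ = Real.exp (-1) := by rw [← Real.exp_add]; ring_nf

theorem pow_sub_pow_le {s t : ℝ} (hs : 0 ≤ s) (hst : s ≤ t) (m : ℕ) :
    t ^ (m + 1) - s ^ (m + 1) ≤ (m + 1) * (t - s) * t ^ m := by
  have ht := hs.trans hst
  induction m with
  | zero => simp
  | succ m ih =>
    have h1 := mul_le_mul_of_nonneg_left ih ht
    have h2 : (t - s) * s ^ (m + 1) ≤ (t - s) * t ^ (m + 1) :=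
      mul_le_mul_of_nonneg_left (pow_le_pow_left₀ hs hst _) (sub_nonneg.2 hst)
    push_cast
    rw [pow_succ s (m + 1), pow_succ t (m + 1)]
    have h3 : t * ((m + 1) * (t - s) * t ^ m) = (m + 1) * (t - s) * t ^ (m + 1) := by ring
    nlinarith

theorem IsPMF.le_one {p : ℕ → ℝ} (hp : IsPMF p) (u : ℕ) : p u ≤ 1 :=
  le_hasSum hp.2 u fun v _ => hp.1 v

theorem IsPMF.add_le_one {p : ℕ → ℝ} (hp : IsPMF p) {u v : ℕ} (huv : u ≠ v) : p u + p v ≤ 1 := by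
  have h := sum_le_hasSum {u, v} (fun w _ => hp.1 w) hp.2
  rwa [Finset.sum_pair huv] at h

/-- The contribution of the symbol `u` to the error of the Good-Turing estimator,
as a function of the number `i` of its appearances. -/
def gtErr (n : ℕ) (p : ℕ → ℝ) (u i : ℕ) : ℝ :=
  (if i = 1 then 1 / (n : ℝ) else 0) - if i = 0 then p u else 0

theorem hasSum_singletons {n : ℕ} (x : Fin n → ℕ) :
    HasSum (fun u => if nOcc x u = 1 then 1 / (n : ℝ) else 0) (goodTuring x) := by
  have h : goodTuring x = ∑ u ∈ Finset.univ.image x, if nOcc x u = 1 then 1 / (n : ℝ) else 0 := by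
    rw [← Finset.sum_filter, Finset.sum_const, nsmul_eq_mul, goodTuring, phi, mul_one_div]
  rw [h]
  refine hasSum_sum_of_ne_finset_zero fun u hu => if_neg fun h1 => hu ?_
  have hne : (Finset.univ.filter fun i => x i = u).Nonempty := by
    rw [nOcc] at h1
    exact Finset.card_pos.1 (h1 ▸ Nat.one_pos)
  obtain ⟨i, hi⟩ := hne
  exact Finset.mem_image.2 ⟨i, Finset.mem_univ i, (Finset.mem_filter.1 hi).2⟩

theorem goodTuring_mem_Icc {n : ℕ} (x : Fin n → ℕ) : goodTuring x ∈ Set.Icc (0 : ℝ) 1 := by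
  refine ⟨div_nonneg (Nat.cast_nonneg _) (Nat.cast_nonneg _), ?_⟩
  refine div_le_one_of_le₀ (Nat.cast_le.2 ?_) (Nat.cast_nonneg _)
  refine (Finset.card_filter_le _ _).trans (Finset.card_image_le.trans ?_)
  simp

theorem hasSum_missingMass {n : ℕ} {p : ℕ → ℝ} (hp : IsPMF p) (x : Fin n → ℕ) :
    HasSum (fun u => if nOcc x u = 0 then p u else 0) (missingMass p x) :=
  (summable_missingMass hp x).hasSum

theorem hasSum_gtErr {n : ℕ} {p : ℕ → ℝ} (hp : IsPMF p) (x : Fin n → ℕ) :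
    HasSum (fun u => gtErr n p u (nOcc x u)) (goodTuring x - missingMass p x) :=
  (hasSum_singletons x).sub (hasSum_missingMass hp x)

theorem hasSum_abs_gtErr {n : ℕ} {p : ℕ → ℝ} (hp : IsPMF p) (x : Fin n → ℕ) :
    HasSum (fun u => |gtErr n p u (nOcc x u)|) (goodTuring x + missingMass p x) := by
  refine ((hasSum_singletons x).add (hasSum_missingMass hp x)).congr_fun fun u => ?_
  rw [gtErr]
  split_ifs with h1 h2 h2
  · omega
  · simp
  · simp [abs_of_nonneg (hp.1 u)]
  · simp

theorem hasSum_expct_gtErr_mul {n : ℕ} {p : ℕ → ℝ} (hp : IsPMF p) :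
    HasSum (fun z : ℕ × ℕ =>
      expct n p fun x => gtErr n p z.1 (nOcc x z.1) * gtErr n p z.2 (nOcc x z.2))
      (risk n p goodTuring) := by
  set F : (Fin n → ℕ) × (ℕ × ℕ) → ℝ := fun y =>
    sampleProb p y.1 * (gtErr n p y.2.1 (nOcc y.1 y.2.1) * gtErr n p y.2.2 (nOcc y.1 y.2.2)) with hF
  have habs : ∀ x : Fin n → ℕ, HasSum (fun z : ℕ × ℕ => |F (x, z)|)
      (sampleProb p x * ((goodTuring x + missingMass p x) * (goodTuring x + missingMass p x))) := by
    intro x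
    have h := hasSum_abs_gtErr hp x
    have h2 := (h.mul h (h.summable.mul_of_nonneg h.summable (fun _ => abs_nonneg _)
      fun _ => abs_nonneg _)).mul_left (sampleProb p x)
    refine h2.congr_fun fun z => ?_
    simp only [hF, abs_mul, abs_of_nonneg (sampleProb_nonneg hp x)]
  have hFs : Summable F := by
    refine Summable.of_abs ((summable_prod_of_nonneg fun _ => abs_nonneg _).2
      ⟨fun x => (habs x).summable, ?_⟩)
    simp only [(habs _).tsum_eq]
    refine summable_sampleProb_mul hp (C := 4) fun x => ?_
    obtain ⟨h1, h2⟩ := goodTuring_mem_Icc x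
    obtain ⟨h3, h4⟩ := missingMass_mem_Icc hp x
    rw [abs_of_nonneg (by positivity)]
    nlinarith
  have hx : ∀ x : Fin n → ℕ, HasSum (fun z : ℕ × ℕ => F (x, z))
      (sampleProb p x * (goodTuring x - missingMass p x) ^ 2) := by
    intro x
    have h := hasSum_gtErr hp x
    have ha := (hasSum_abs_gtErr hp x).summable
    have hs : Summable fun z : ℕ × ℕ =>
        gtErr n p z.1 (nOcc x z.1) * gtErr n p z.2 (nOcc x z.2) :=
      summable_mul_of_summable_norm (f := fun u => gtErr n p u (nOcc x u))
        (g := fun u => gtErr n p u (nOcc x u)) ha ha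
    rw [sq]
    exact (h.mul h hs).mul_left (sampleProb p x)
  have h1 : HasSum F (risk n p goodTuring) := by
    have h := hFs.hasSum.prod_fiberwise hx
    rw [risk, expct, h.tsum_eq]
    exact hFs.hasSum
  have h2 : HasSum (fun y : (ℕ × ℕ) × (Fin n → ℕ) => F (y.2, y.1)) (risk n p goodTuring) :=
    (Equiv.prodComm (ℕ × ℕ) (Fin n → ℕ)).hasSum_iff.2 h1
  have h3 : ∀ z : ℕ × ℕ, HasSum (fun x => F (x, z)) (∑' x, F (x, z)) := fun z =>
    (h2.summable.prod_factor z).hasSum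
  exact h2.prod_fiberwise h3

theorem expct_gtErr_mul_le {p : ℕ → ℝ} (hp : IsPMF p) {u v : ℕ} (huv : u ≠ v) (k : ℕ) :
    ((k + 3 : ℕ) : ℝ) * (expct (k + 3) p fun x =>
      gtErr (k + 3) p u (nOcc x u) * gtErr (k + 3) p v (nOcc x v)) ≤
      p u * p v * (2 * (k + 3) / (k + 1) ^ 2 + 1 / (k + 1)) -
      p u * (1 - p u) ^ (k + 2) * (p v * (1 - p v) ^ (k + 2)) := by
  rw [expct_occ_pair hp huv (k + 3) (fun i j => gtErr (k + 3) p u i * gtErr (k + 3) p v j)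
    (fun i j => by simp [gtErr]) (fun i j => by simp [gtErr])]
  have hu0 := hp.1 u
  have hv0 := hp.1 v
  have hu1 := hp.le_one u
  have hv1 := hp.le_one v
  have huv1 := hp.add_le_one huv
  set a := p u with ha
  set b := p v with hb
  have hs : 0 ≤ 1 - a - b := by linarith
  have hk : (0 : ℝ) < k + 1 := by positivity
  have hk3 : (k : ℝ) + 3 ≠ 0 := by positivity
  have hformula : ((k + 3 : ℕ) : ℝ) * (gtErr (k + 3) p u 0 * gtErr (k + 3) p v 0 * (1 - a - b) ^ (k + 3) +
      ((k + 3 : ℕ) : ℝ) * a * (gtErr (k + 3) p u 1 * gtErr (k + 3) p v 0) * (1 - a - b) ^ (k + 3 - 1) +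
      ((k + 3 : ℕ) : ℝ) * b * (gtErr (k + 3) p u 0 * gtErr (k + 3) p v 1) * (1 - a - b) ^ (k + 3 - 1) +
      ((k + 3 : ℕ) : ℝ) * (((k + 3 : ℕ) : ℝ) - 1) * a * b * (gtErr (k + 3) p u 1 * gtErr (k + 3) p v 1) *
        (1 - a - b) ^ (k + 3 - 2)) =
      a * b * ((k + 3) * ((a + b) ^ 2 * (1 - (a + b)) ^ (k + 1))) - a * b * (1 - a - b) ^ (k + 1) := by
    simp only [gtErr, ← ha, ← hb, show k + 3 - 1 = k + 2 by omega, show k + 3 - 2 = k + 1 by omega,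
      if_pos, if_neg one_ne_zero, if_neg (zero_ne_one' ℕ), Nat.cast_add, Nat.cast_ofNat]
    field_simp
    ring
  refine hformula.le.trans ?_
  have hab : 0 ≤ a * b := mul_nonneg hu0 hv0
  have h1 : (k + 3) * ((a + b) ^ 2 * (1 - (a + b)) ^ (k + 1)) ≤ 2 * (k + 3) / (k + 1) ^ 2 := by
    have h := sq_mul_one_sub_pow_le (add_nonneg hu0 hv0) huv1 (k + 1)
    push_cast at h
    rw [le_div_iff₀ (by positivity)]
    have h' := mul_le_mul_of_nonneg_left h (show (0 : ℝ) ≤ k + 3 by positivity)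
    linarith
  have h2 : (1 - a) ^ (k + 2) * (1 - b) ^ (k + 2) - (1 - a - b) ^ (k + 1) ≤ 1 / (k + 1) := by
    have ha' : 0 ≤ 1 - a := sub_nonneg.2 hu1
    have hb' : 0 ≤ 1 - b := sub_nonneg.2 hv1
    have ht0 : 0 ≤ (1 - a) * (1 - b) := mul_nonneg ha' hb'
    have ht1 : (1 - a) * (1 - b) ≤ 1 := mul_le_one₀ (by linarith) hb' (by linarith)
    have h3 := pow_sub_pow_le hs (show 1 - a - b ≤ (1 - a) * (1 - b) by nlinarith) k
    have h4 := mul_one_sub_pow_le hu0 hu1 k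
    have h5 := mul_one_sub_pow_le hv0 hv1 k
    have h6 : (1 - a) ^ (k + 2) * (1 - b) ^ (k + 2) ≤ ((1 - a) * (1 - b)) ^ (k + 1) := by
      rw [← mul_pow]
      exact pow_le_pow_of_le_one ht0 ht1 (by omega)
    rw [le_div_iff₀ hk]
    have h7 := mul_le_one₀ h4 (by positivity) h5
    have h8 : (k + 1) * ((1 - a) * (1 - b) - (1 - a - b)) * ((1 - a) * (1 - b)) ^ k * (k + 1) =
        (k + 1) * (a * (1 - a) ^ k) * ((k + 1) * (b * (1 - b) ^ k)) := by
      rw [mul_pow]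
      ring
    have h9 := mul_le_mul_of_nonneg_right ((sub_le_sub_right h6 _).trans h3) hk.le
    linarith
  have h10 := mul_le_mul_of_nonneg_left h1 hab
  have h11 := mul_le_mul_of_nonneg_left h2 hab
  linarith

theorem expct_gtErr_sq_le {p : ℕ → ℝ} (hp : IsPMF p) (u k : ℕ) :
    ((k + 3 : ℕ) : ℝ) * (expct (k + 3) p fun x =>
      gtErr (k + 3) p u (nOcc x u) * gtErr (k + 3) p u (nOcc x u)) ≤
      p u * (1 - p u) ^ (k + 2) + p u * Real.exp (-1) + p u * (1 / (k + 3)) -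
      p u * (1 - p u) ^ (k + 2) * (p u * (1 - p u) ^ (k + 2)) := by
  rw [expct_occ_single hp u (k + 3) (fun i => gtErr (k + 3) p u i * gtErr (k + 3) p u i)
    (fun i => by simp [gtErr])]
  have hu0 := hp.1 u
  have hu1 := hp.le_one u
  set a := p u with ha
  have ha' : 0 ≤ 1 - a := sub_nonneg.2 hu1
  have hk3 : (0 : ℝ) < (k : ℝ) + 3 := by positivity
  have hformula : ((k + 3 : ℕ) : ℝ) * (gtErr (k + 3) p u 0 * gtErr (k + 3) p u 0 * (1 - a) ^ (k + 3) +
      ((k + 3 : ℕ) : ℝ) * a * (gtErr (k + 3) p u 1 * gtErr (k + 3) p u 1) * (1 - a) ^ (k + 3 - 1)) =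
      a * (1 - a) ^ (k + 2) + a * (((k + 3 : ℕ) : ℝ) * a * (1 - a) ^ (k + 3)) := by
    simp only [gtErr, ← ha, show k + 3 - 1 = k + 2 by omega,
      if_pos, if_neg one_ne_zero, if_neg (zero_ne_one' ℕ), Nat.cast_add, Nat.cast_ofNat]
    field_simp
    ring
  refine hformula.le.trans ?_
  have h1 := mul_le_mul_of_nonneg_left (mul_mul_one_sub_pow_le_exp hu0 hu1 (k + 3)) hu0
  have h2 : a * (1 - a) ^ (k + 2) * (a * (1 - a) ^ (k + 2)) ≤ a * (1 / (k + 3)) := by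
    have h3 := mul_one_sub_pow_le hu0 hu1 (k + 2)
    push_cast at h3
    refine mul_le_mul (mul_le_of_le_one_right hu0 (pow_le_one₀ ha' (by linarith))) ?_
      (by positivity) hu0
    rw [le_div_iff₀ hk3]
    linarith
  linarith

theorem risk_goodTuring_le {p : ℕ → ℝ} (hp : IsPMF p) (k : ℕ) :
    ((k + 3 : ℕ) : ℝ) * risk (k + 3) p goodTuring ≤
      1 / 4 + Real.exp (-1) + (1 / (k + 3) + (2 * (k + 3) / (k + 1) ^ 2 + 1 / (k + 1))) := by
  set C : ℝ := 2 * (k + 3) / (k + 1) ^ 2 + 1 / (k + 1) with hC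
  have hC0 : 0 ≤ C := by positivity
  set a : ℕ → ℝ := fun u => p u * (1 - p u) ^ (k + 2) with ha
  have ha0 : ∀ u, 0 ≤ a u := fun u =>
    mul_nonneg (hp.1 u) (pow_nonneg (sub_nonneg.2 (hp.le_one u)) _)
  have has : Summable a := Summable.of_nonneg_of_le ha0 (fun u =>
    mul_le_of_le_one_right (hp.1 u)
      (pow_le_one₀ (sub_nonneg.2 (hp.le_one u)) (sub_le_self _ (hp.1 u)))) hp.2.summable
  obtain ⟨A, hA⟩ := has
  have hdiag : HasSum (fun z : ℕ × ℕ => if z.1 = z.2 then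
      a z.1 + p z.1 * Real.exp (-1) + p z.1 * (1 / (k + 3)) else 0)
      (A + 1 * Real.exp (-1) + 1 * (1 / (k + 3))) := by
    have hinj : Function.Injective fun u : ℕ => (u, u) := fun u v h => (Prod.ext_iff.1 h).1
    rw [← hinj.hasSum_iff]
    · have h := (hA.add (hp.2.mul_right (Real.exp (-1)))).add (hp.2.mul_right (1 / ((k : ℝ) + 3)))
      exact h.congr_fun fun u => by simp
    · rintro ⟨u, v⟩ h
      exact if_neg fun huv => h ⟨u, Prod.ext rfl huv⟩
  have hpp := (hp.2.mul hp.2 (hp.2.summable.mul_of_nonneg hp.2.summable hp.1 hp.1)).mul_right C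
  have haa := hA.mul hA (hA.summable.mul_of_nonneg hA.summable ha0 ha0)
  have hB := (hdiag.add hpp).sub haa
  have hR := (hasSum_expct_gtErr_mul (n := k + 3) hp).mul_left ((k + 3 : ℕ) : ℝ)
  refine (hasSum_le ?_ hR hB).trans ?_
  · rintro ⟨u, v⟩
    by_cases huv : u = v
    · subst huv
      have h := expct_gtErr_sq_le hp u k
      have h0 : 0 ≤ p u * p u * C := mul_nonneg (mul_nonneg (hp.1 u) (hp.1 u)) hC0
      simp only [if_true, ha]
      linarith
    · have h := expct_gtErr_mul_le hp huv k
      simp only [if_neg huv, ha, zero_add]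
      exact h
  · nlinarith [sq_nonneg (A - 1 / 2)]

theorem minimaxRisk_le_of_four_le {n : ℕ} (hn : 4 ≤ n) :
    (n : ℝ) * minimaxRisk n ≤ 1 / 4 + Real.exp (-1) + 15 / n := by
  obtain ⟨k, rfl⟩ : ∃ k, n = k + 1 + 3 := ⟨n - 4, by omega⟩
  have hn0 : (0 : ℝ) < ((k + 1 + 3 : ℕ) : ℝ) := by positivity
  rw [mul_comm, ← le_div_iff₀ hn0]
  refine minimaxRisk_le goodTuring_mem_Icc (fun p hp => ?_) (by positivity)
  rw [le_div_iff₀ hn0, mul_comm]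
  refine (risk_goodTuring_le hp (k + 1)).trans (add_le_add_right ?_ _)
  push_cast
  rw [← sub_nonneg]
  have : (15 : ℝ) / (k + 1 + 3) - (1 / (k + 1 + 3) + (2 * (k + 1 + 3) / (k + 1 + 1) ^ 2 + 1 / (k + 1 + 1))) =
      (11 * (k : ℝ) ^ 2 + 34 * k + 16) / ((k + 1 + 3) * (k + 1 + 1) ^ 2) := by
    field_simp
    ring
  rw [this]
  positivity

/-- The pmf with an atom of mass `1 - θ` at `0` and mass `θ` uniformly spread over `1, …, K`. -/
def atomUniform (θ : ℝ) (K u : ℕ) : ℝ :=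
  if u = 0 then 1 - θ else if u ≤ K then θ / K else 0

theorem isPMF_atomUniform {θ : ℝ} (h0 : 0 ≤ θ) (h1 : θ ≤ 1) {K : ℕ} (hK : 0 < K) :
    IsPMF (atomUniform θ K) := by
  constructor
  · intro u
    rw [atomUniform]
    split_ifs
    · linarith
    · positivity
    · exact le_rfl
  · have h : ∑ u ∈ Finset.range (K + 1), atomUniform θ K u = 1 := by
      rw [Finset.sum_range_succ']
      have h2 : ∀ u ∈ Finset.range K, atomUniform θ K (u + 1) = θ / K := fun u hu => by
        rw [atomUniform, if_neg u.succ_ne_zero, if_pos (Nat.succ_le_of_lt (Finset.mem_range.1 hu))]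
      rw [Finset.sum_congr rfl h2, Finset.sum_const, Finset.card_range, nsmul_eq_mul,
        mul_div_cancel₀ _ (Nat.cast_ne_zero.2 hK.ne'), atomUniform, if_pos rfl]
      ring
    rw [← h]
    refine hasSum_sum_of_ne_finset_zero fun u hu => ?_
    rw [Finset.mem_range, not_lt] at hu
    rw [atomUniform, if_neg (by omega), if_neg (by omega)]

theorem expct_atomUniform (n : ℕ) (θ : ℝ) (K : ℕ) (f : (Fin n → ℕ) → ℝ) :
    expct n (atomUniform θ K) f =
      ∑ x ∈ Fintype.piFinset fun _ : Fin n => Finset.range (K + 1),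
        (1 - θ) ^ nOcc x 0 * (θ / K) ^ (n - nOcc x 0) * f x := by
  rw [expct, tsum_eq_sum (s := Fintype.piFinset fun _ : Fin n => Finset.range (K + 1))]
  · refine Finset.sum_congr rfl fun x hx => ?_
    congr 1
    have h : ∀ i, atomUniform θ K (x i) = if x i = 0 then 1 - θ else θ / K := fun i => by
      have hi := Finset.mem_range.1 (Fintype.mem_piFinset.1 hx i)
      rw [atomUniform, if_pos (Nat.le_of_lt_succ hi)]
    have hc : (Finset.univ.filter fun i => ¬ x i = 0).card = n - nOcc x 0 := by
      have h2 := Finset.card_filter_add_card_filter_not (s := Finset.univ) fun i => x i = 0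
      rw [Finset.card_univ, Fintype.card_fin] at h2
      rw [nOcc]
      omega
    rw [sampleProb, Finset.prod_congr rfl fun i _ => h i, Finset.prod_ite, Finset.prod_const,
      Finset.prod_const, hc, nOcc]
  · intro x hx
    rw [Fintype.mem_piFinset, not_forall] at hx
    obtain ⟨i, hi⟩ := hx
    rw [Finset.mem_range, not_lt] at hi
    have h : atomUniform θ K (x i) = 0 := by
      rw [atomUniform, if_neg (by omega), if_neg (by omega)]
    rw [sampleProb, Finset.prod_eq_zero (Finset.mem_univ i) h, zero_mul]

theorem missingMass_atomUniform {n : ℕ} (θ : ℝ) {K : ℕ} (hK : 0 < K) (x : Fin n → ℕ) :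
    missingMass (atomUniform θ K) x = (if nOcc x 0 = 0 then 1 - θ else 0) + θ -
      θ / K * ((Finset.range K).filter fun u => ¬ nOcc x (u + 1) = 0).card := by
  have hsum : missingMass (atomUniform θ K) x =
      ∑ u ∈ Finset.range (K + 1), if nOcc x u = 0 then atomUniform θ K u else 0 := by
    refine tsum_eq_sum fun u hu => ?_
    rw [Finset.mem_range, not_lt] at hu
    rw [atomUniform, if_neg (show ¬ u = 0 by omega), if_neg (show ¬ u ≤ K by omega), ite_self]
  have hK' : (K : ℝ) ≠ 0 := Nat.cast_ne_zero.2 hK.ne'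
  have h2 : ∀ u ∈ Finset.range K, (if nOcc x (u + 1) = 0 then atomUniform θ K (u + 1) else 0) =
      θ / K - if ¬ nOcc x (u + 1) = 0 then θ / K else 0 := fun u hu => by
    rw [atomUniform, if_neg u.succ_ne_zero, if_pos (Nat.succ_le_of_lt (Finset.mem_range.1 hu))]
    split_ifs <;> simp
  rw [hsum, Finset.sum_range_succ', Finset.sum_congr rfl h2, Finset.sum_sub_distrib,
    ← Finset.sum_filter, Finset.sum_const, Finset.sum_const, Finset.card_range, nsmul_eq_mul,
    nsmul_eq_mul, mul_div_cancel₀ _ hK', atomUniform, if_pos rfl]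
  ring

theorem abs_missingMass_atomUniform_sub_le {n : ℕ} {θ : ℝ} (h0 : 0 ≤ θ) (h1 : θ ≤ 1) {K : ℕ}
    (hK : 0 < K) (x : Fin n → ℕ) :
    |missingMass (atomUniform θ K) x - θ| ≤ (if nOcc x 0 = 0 then 1 - θ else 0) + n / K := by
  have hcard : ((Finset.range K).filter fun u => ¬ nOcc x (u + 1) = 0).card ≤ n := by
    calc ((Finset.range K).filter fun u => ¬ nOcc x (u + 1) = 0).card
        ≤ (Finset.univ.image x).card := by
          refine Finset.card_le_card_of_injOn (fun u => u + 1) (fun u hu => ?_)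
            (fun u _ v _ h => Nat.succ_injective h)
          have hne := (Finset.mem_filter.1 hu).2
          obtain ⟨i, hi⟩ := Finset.card_pos.1 (Nat.pos_of_ne_zero hne)
          exact Finset.mem_image.2 ⟨i, Finset.mem_univ i, (Finset.mem_filter.1 hi).2⟩
      _ ≤ n := by simpa using Finset.card_image_le (s := Finset.univ) (f := x)
  have hK' : (0 : ℝ) < K := Nat.cast_pos.2 hK
  have h2 : θ / K * (((Finset.range K).filter fun u => ¬ nOcc x (u + 1) = 0).card : ℝ) ≤ n / K := by
    rw [div_mul_eq_mul_div]
    refine div_le_div_of_nonneg_right ?_ hK'.le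
    calc θ * _ ≤ 1 * (n : ℝ) :=
          mul_le_mul h1 (Nat.cast_le.2 hcard) (Nat.cast_nonneg _) zero_le_one
      _ = n := one_mul _
  have h3 : 0 ≤ θ / K * (((Finset.range K).filter fun u => ¬ nOcc x (u + 1) = 0).card : ℝ) := by
    positivity
  have h4 : (0 : ℝ) ≤ if nOcc x 0 = 0 then 1 - θ else 0 := by
    split_ifs
    · linarith
    · exact le_rfl
  rw [missingMass_atomUniform θ hK, abs_le]
  constructor <;> linarith

theorem le_risk_atomUniform {n : ℕ} {θ : ℝ} (h0 : 0 ≤ θ) (h1 : θ ≤ 1) {K : ℕ} (hK : 0 < K)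
    {M : (Fin n → ℕ) → ℝ} (hM : ∀ x, M x ∈ Set.Icc (0 : ℝ) 1) :
    expct n (atomUniform θ K) (fun x => (M x - θ) ^ 2) ≤
      risk n (atomUniform θ K) M + 2 * ((1 - θ) * θ ^ n) + 2 * (n / K) := by
  have hp := isPMF_atomUniform h0 h1 hK
  have hpoint : ∀ x, (M x - θ) ^ 2 ≤ (M x - missingMass (atomUniform θ K) x) ^ 2 +
      2 * (if nOcc x 0 = 0 then 1 - θ else 0) + 2 * (n / K) := by
    intro x
    obtain ⟨hM0, hM1⟩ := hM x
    obtain ⟨hm0, hm1⟩ := missingMass_mem_Icc hp x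
    have h := abs_missingMass_atomUniform_sub_le h0 h1 hK x
    set m := missingMass (atomUniform θ K) x
    have h2 : |2 * M x - θ - m| ≤ 2 := by
      rw [abs_le]
      constructor <;> linarith
    have h3 : (M x - θ) ^ 2 - (M x - m) ^ 2 ≤ |m - θ| * 2 := by
      calc (M x - θ) ^ 2 - (M x - m) ^ 2 = (m - θ) * (2 * M x - θ - m) := by ring
        _ ≤ |m - θ| * |2 * M x - θ - m| := by rw [← abs_mul]; exact le_abs_self _
        _ ≤ |m - θ| * 2 := mul_le_mul_of_nonneg_left h2 (abs_nonneg _)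
    linarith
  have hzero : expct n (atomUniform θ K) (fun x => if nOcc x 0 = 0 then 1 - θ else 0) =
      (1 - θ) * θ ^ n := by
    rw [expct_occ_single hp 0 n (fun i => if i = 0 then 1 - θ else 0) fun i => by simp]
    simp [atomUniform]
  have hconst := expct_const hp n (2 * ((n : ℝ) / K))
  rw [← hconst, ← hzero, risk, expct_atomUniform, expct_atomUniform, expct_atomUniform,
    expct_atomUniform, Finset.mul_sum, ← Finset.sum_add_distrib, ← Finset.sum_add_distrib]
  refine Finset.sum_le_sum fun x _ => ?_
  have hw : 0 ≤ (1 - θ) ^ nOcc x 0 * (θ / K) ^ (n - nOcc x 0) :=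
    mul_nonneg (pow_nonneg (sub_nonneg.2 h1) _) (by positivity)
  have h := mul_le_mul_of_nonneg_left (hpoint x) hw
  linarith

/-- The posterior mean of `θ` for the prior `Beta(b + 1, b + 1)`. -/
def posteriorMean {n : ℕ} (b : ℕ) (x : Fin n → ℕ) : ℝ :=
  (((n - nOcc x 0 : ℕ) : ℝ) + (b + 1)) / (n + 2 * (b + 1))

theorem le_expct_posteriorMean_sub_sq {θ : ℝ} (h0 : 0 ≤ θ) (h1 : θ ≤ 1) {K : ℕ} (hK : 0 < K)
    (n b : ℕ) :
    n / ((n : ℝ) + 2 * (b + 1)) ^ 2 * (θ * (1 - θ)) ≤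
      expct n (atomUniform θ K) fun x => (posteriorMean b x - θ) ^ 2 := by
  have hd : (0 : ℝ) < (n : ℝ) + 2 * (b + 1) := by positivity
  have h := expct_occ_sub_sq (isPMF_atomUniform h0 h1 hK) 0 n (n + (b + 1) - (n + 2 * (b + 1)) * θ)
  have h2 : (expct n (atomUniform θ K) fun x => (posteriorMean b x - θ) ^ 2) =
      ((n : ℝ) + 2 * (b + 1))⁻¹ ^ 2 * expct n (atomUniform θ K) (fun x =>
        ((nOcc x 0 : ℝ) - (n + (b + 1) - (n + 2 * (b + 1)) * θ)) ^ 2) := by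
    rw [expct, expct, ← tsum_mul_left]
    refine tsum_congr fun x => ?_
    rw [posteriorMean, Nat.cast_sub (nOcc_le x 0)]
    field_simp
    ring
  rw [h2, h]
  have h3 : atomUniform θ K 0 = 1 - θ := if_pos rfl
  rw [h3, inv_pow, div_mul_eq_mul_div, div_eq_inv_mul]
  refine mul_le_mul_of_nonneg_left ?_ (by positivity)
  have h4 := sq_nonneg (n * (1 - θ) - (n + (b + 1) - (n + 2 * (b + 1)) * θ))
  linarith

theorem hasDerivAt_pow_mul_one_sub_pow (i j : ℕ) (θ : ℝ) :
    HasDerivAt (fun θ : ℝ => θ ^ (i + 1) * (1 - θ) ^ (j + 1))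
      (θ ^ i * (1 - θ) ^ j * ((i + 1) - (i + 1 + (j + 1)) * θ)) θ := by
  have h1 := hasDerivAt_pow (i + 1) θ
  have h2 := ((hasDerivAt_id θ).const_sub 1).fun_pow (j + 1)
  refine (h1.fun_mul h2).congr_deriv ?_
  simp only [Nat.add_sub_cancel, id]
  push_cast
  ring

/-- The normalizing constant of the density of `Beta(b + 1, b + 1)`. -/
def betaNorm (b : ℕ) : ℝ := ∫ θ in (0 : ℝ)..1, (θ * (1 - θ)) ^ b

theorem betaNorm_pos (b : ℕ) : 0 < betaNorm b := by
  refine intervalIntegral.intervalIntegral_pos_of_pos_on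
    (Continuous.intervalIntegrable (by fun_prop) _ _) (fun θ hθ => ?_) zero_lt_one
  exact pow_pos (mul_pos hθ.1 (sub_pos.2 hθ.2)) b

theorem betaNorm_succ (b : ℕ) : (4 * b + 6) * betaNorm (b + 1) = (b + 1) * betaNorm b := by
  have hderiv : ∀ θ : ℝ, HasDerivAt (fun θ : ℝ => (θ * (1 - θ)) ^ (b + 1) * (1 - 2 * θ))
      ((b + 1) * (θ * (1 - θ)) ^ b - (4 * b + 6) * (θ * (1 - θ)) ^ (b + 1)) θ := by
    intro θ
    have h1 := (((hasDerivAt_id θ).fun_mul ((hasDerivAt_id θ).const_sub 1)).fun_pow (b + 1)).fun_mul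
      (((hasDerivAt_id θ).const_mul 2).const_sub 1)
    refine h1.congr_deriv ?_
    simp only [Nat.add_sub_cancel, id]
    push_cast
    ring
  have h := intervalIntegral.integral_eq_sub_of_hasDerivAt (a := 0) (b := 1)
    (fun θ _ => hderiv θ) (Continuous.intervalIntegrable (by fun_prop) _ _)
  rw [intervalIntegral.integral_sub (Continuous.intervalIntegrable (by fun_prop) _ _)
    (Continuous.intervalIntegrable (by fun_prop) _ _), intervalIntegral.integral_const_mul,
    intervalIntegral.integral_const_mul] at h
  simp only [mul_zero, zero_mul, sub_self, ne_eq, Nat.succ_ne_zero, not_false_eq_true,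
    zero_pow, mul_one] at h
  rw [betaNorm, betaNorm]
  linarith

theorem exists_weighted_risk_bound {n K b : ℕ} (hn : 0 < n) (hK : 0 < K) (hb : 0 < b)
    {M : (Fin n → ℕ) → ℝ} (hM : ∀ x, M x ∈ Set.Icc (0 : ℝ) 1) {S : ℝ}
    (hS : ∀ p, IsPMF p → risk n p M ≤ S) :
    ∃ Q Q' : ℝ → ℝ, (∀ θ, HasDerivAt Q (Q' θ) θ) ∧ Continuous Q' ∧ Q 0 = 0 ∧ Q 1 = 0 ∧
      ∀ θ ∈ Set.Icc (0 : ℝ) 1,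
        n / ((n : ℝ) + 2 * (b + 1)) ^ 2 * (θ * (1 - θ)) ^ (b + 1) + Q' θ ≤
          (S + 2 * (n / K)) * (θ * (1 - θ)) ^ b + 4 / (n : ℝ) ^ 2 := by
  set F := Fintype.piFinset fun _ : Fin n => Finset.range (K + 1) with hF
  set κ : (Fin n → ℕ) → ℝ := fun x =>
    2 * (M x - posteriorMean b x) * (K : ℝ)⁻¹ ^ (n - nOcc x 0) / (n + 2 * (b + 1)) with hκ
  have hd : (0 : ℝ) < (n : ℝ) + 2 * (b + 1) := by positivity
  refine ⟨fun θ => ∑ x ∈ F, κ x * (θ ^ (n - nOcc x 0 + b + 1) * (1 - θ) ^ (nOcc x 0 + b + 1)),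
    fun θ => ∑ x ∈ F, κ x * (θ ^ (n - nOcc x 0 + b) * (1 - θ) ^ (nOcc x 0 + b) *
      ((((n - nOcc x 0 + b : ℕ) : ℝ) + 1) -
        (((n - nOcc x 0 + b : ℕ) : ℝ) + 1 + (((nOcc x 0 + b : ℕ) : ℝ) + 1)) * θ)),
    fun θ => HasDerivAt.fun_sum fun x _ => (hasDerivAt_pow_mul_one_sub_pow _ _ θ).const_mul _,
    by fun_prop, by simp, by simp, ?_⟩
  rintro θ ⟨h0, h1⟩
  have h1' : 0 ≤ 1 - θ := sub_nonneg.2 h1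
  have hp := isPMF_atomUniform h0 h1 hK
  have hw : 0 ≤ (θ * (1 - θ)) ^ b := pow_nonneg (mul_nonneg h0 h1') b
  have hrisk := (le_risk_atomUniform h0 h1 hK hM).trans
    (add_le_add_left (add_le_add_left (hS _ hp) _) _)
  have hpost := le_expct_posteriorMean_sub_sq h0 h1 hK n b
  have hQ : (∑ x ∈ F, κ x * (θ ^ (n - nOcc x 0 + b) * (1 - θ) ^ (nOcc x 0 + b) *
      ((((n - nOcc x 0 + b : ℕ) : ℝ) + 1) -
        (((n - nOcc x 0 + b : ℕ) : ℝ) + 1 + (((nOcc x 0 + b : ℕ) : ℝ) + 1)) * θ))) =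
      (θ * (1 - θ)) ^ b * expct n (atomUniform θ K) fun x =>
        2 * (M x - posteriorMean b x) * (posteriorMean b x - θ) := by
    rw [expct_atomUniform, Finset.mul_sum]
    refine Finset.sum_congr rfl fun x _ => ?_
    have hN := nOcc_le x 0
    simp only [hκ, posteriorMean, Nat.cast_add, Nat.cast_sub hN, pow_add, div_pow, mul_pow, inv_pow]
    field_simp
    ring
  have hsplit : (expct n (atomUniform θ K) fun x => (posteriorMean b x - θ) ^ 2) +
      (expct n (atomUniform θ K) fun x => 2 * (M x - posteriorMean b x) * (posteriorMean b x - θ)) ≤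
      expct n (atomUniform θ K) fun x => (M x - θ) ^ 2 := by
    rw [expct_atomUniform, expct_atomUniform, expct_atomUniform, ← Finset.sum_add_distrib]
    refine Finset.sum_le_sum fun x _ => ?_
    rw [← mul_add]
    refine mul_le_mul_of_nonneg_left ?_ (mul_nonneg (pow_nonneg h1' _) (by positivity))
    have := sq_nonneg (M x - posteriorMean b x)
    linarith
  have hall := mul_le_mul_of_nonneg_left ((add_le_add_left hpost _).trans (hsplit.trans hrisk)) hw
  have herr : (θ * (1 - θ)) ^ b * ((1 - θ) * θ ^ n) ≤ 2 / (n : ℝ) ^ 2 := by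
    have h2 : (θ * (1 - θ)) ^ b ≤ 1 - θ :=
      (pow_le_of_le_one (mul_nonneg h0 h1') (mul_le_one₀ h1 h1' (by linarith)) hb.ne').trans
        (mul_le_of_le_one_left h1' h1)
    have h3 := sq_mul_one_sub_pow_le h1' (sub_le_self 1 h0) n
    rw [sub_sub_cancel] at h3
    refine (mul_le_mul_of_nonneg_right h2 (mul_nonneg h1' (pow_nonneg h0 n))).trans ?_
    rw [le_div_iff₀ (by positivity)]
    linarith
  have h4 : 4 / (n : ℝ) ^ 2 = 2 * (2 / (n : ℝ) ^ 2) := by ring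
  beta_reduce
  rw [hQ, h4, pow_succ (θ * (1 - θ)) b]
  linarith

theorem le_of_forall_risk_le {n K b : ℕ} (hn : 0 < n) (hK : 0 < K) (hb : 0 < b)
    {M : (Fin n → ℕ) → ℝ} (hM : ∀ x, M x ∈ Set.Icc (0 : ℝ) 1) {S : ℝ}
    (hS : ∀ p, IsPMF p → risk n p M ≤ S) :
    n / ((n : ℝ) + 2 * (b + 1)) ^ 2 * ((b + 1) / (4 * b + 6)) - 2 * (n / K) -
      4 / (n : ℝ) ^ 2 / betaNorm b ≤ S := by
  obtain ⟨Q, Q', hQ, hQ'c, hQ0, hQ1, hle⟩ := exists_weighted_risk_bound hn hK hb hM hS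
  have hint := intervalIntegral.integral_mono_on (μ := MeasureTheory.volume) zero_le_one
    (Continuous.intervalIntegrable (by fun_prop) _ _)
    (Continuous.intervalIntegrable (by fun_prop) _ _) hle
  rw [intervalIntegral.integral_add (Continuous.intervalIntegrable (by fun_prop) _ _)
      (Continuous.intervalIntegrable (by fun_prop) _ _),
    intervalIntegral.integral_add (Continuous.intervalIntegrable (by fun_prop) _ _)
      (Continuous.intervalIntegrable (by fun_prop) _ _),
    intervalIntegral.integral_const_mul, intervalIntegral.integral_const_mul,
    intervalIntegral.integral_eq_sub_of_hasDerivAt (fun θ _ => hQ θ)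
      (hQ'c.intervalIntegrable _ _), hQ0, hQ1, intervalIntegral.integral_const] at hint
  change _ * betaNorm (b + 1) + (0 - 0) ≤ _ * betaNorm b + _ at hint
  have hW := betaNorm_pos b
  have hrec : betaNorm (b + 1) = (b + 1) / (4 * b + 6) * betaNorm b := by
    rw [div_mul_eq_mul_div, eq_div_iff (by positivity), ← betaNorm_succ]
    ring
  rw [hrec] at hint
  simp only [sub_zero, add_zero, smul_eq_mul, one_mul] at hint
  have h : (n / ((n : ℝ) + 2 * (b + 1)) ^ 2 * ((b + 1) / (4 * b + 6)) - 2 * (n / K) - S) *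
      betaNorm b ≤ 4 / (n : ℝ) ^ 2 := by linarith
  rw [← le_div_iff₀ hW] at h
  linarith

theorem le_mul_minimaxRisk {n b : ℕ} (hn : 0 < n) (hb : 0 < b) :
    ((n : ℝ) / (n + 2 * (b + 1))) ^ 2 * ((b + 1) / (4 * b + 6)) -
      (2 + 4 / betaNorm b) / n ≤ n * minimaxRisk n := by
  have hn' : (0 : ℝ) < n := Nat.cast_pos.2 hn
  have h := mul_le_mul_of_nonneg_left (le_minimaxRisk fun M hM S hS =>
    le_of_forall_risk_le hn (pow_pos hn 3) hb hM hS) hn'.le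
  refine le_trans (le_of_eq ?_) h
  have hW := (betaNorm_pos b).ne'
  push_cast
  field_simp
  ring

theorem eventually_le_mul_minimaxRisk {y : ℝ} (hy : y < 1 / 4) :
    ∀ᶠ n : ℕ in Filter.atTop, y ≤ n * minimaxRisk n := by
  have hρ : ∀ b : ℕ, ((b : ℝ) + 1) / (4 * b + 6) = 1 / 4 - 1 / 2 / (4 * b + 6) := fun b => by
    field_simp
    ring
  obtain ⟨b, hb, hyb⟩ : ∃ b : ℕ, 0 < b ∧ y < ((b : ℝ) + 1) / (4 * b + 6) := by
    obtain ⟨b, hb⟩ := exists_nat_gt (1 / (1 / 4 - y))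
    have hy' : 0 < 1 / 4 - y := sub_pos.2 hy
    have hb0 : (0 : ℝ) < b := (one_div_pos.2 hy').trans hb
    refine ⟨b, Nat.cast_pos.1 hb0, ?_⟩
    rw [hρ, lt_sub_comm, div_lt_iff₀ (by positivity)]
    rw [div_lt_iff₀ hy'] at hb
    nlinarith
  have h1 : Filter.Tendsto (fun n : ℕ => (n : ℝ) / (n + 2 * (b + 1))) Filter.atTop (nhds 1) :=
    tendsto_natCast_div_add_atTop (2 * ((b : ℝ) + 1))
  have h2 := ((h1.pow 2).mul_const (((b : ℝ) + 1) / (4 * b + 6))).sub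
    (tendsto_const_div_atTop_nhds_zero_nat (2 + 4 / betaNorm b))
  rw [one_pow, one_mul, sub_zero] at h2
  filter_upwards [h2.eventually_const_lt hyb, Filter.eventually_gt_atTop 0] with n hn hn0
  exact hn.le.trans (le_mul_minimaxRisk hn0 hb)

/-- **Theorem 5 (bounds on the minimax risk of missing mass estimation):**
`1/4 ≤ liminf_{n→∞} n · R*_n` and `limsup_{n→∞} n · R*_n ≤ 1/4 + e⁻¹`. -/
theorem minimax_risk_bounds :
    1 / 4 ≤ Filter.liminf (fun n : ℕ => (n : ℝ) * minimaxRisk n) Filter.atTop ∧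
    Filter.limsup (fun n : ℕ => (n : ℝ) * minimaxRisk n) Filter.atTop ≤
      1 / 4 + Real.exp (-1) := by
  have hupper : ∀ᶠ n : ℕ in Filter.atTop,
      (n : ℝ) * minimaxRisk n ≤ 1 / 4 + Real.exp (-1) + 15 / n :=
    (Filter.eventually_ge_atTop 4).mono fun n hn => minimaxRisk_le_of_four_le hn
  have htend : Filter.Tendsto (fun n : ℕ => 1 / 4 + Real.exp (-1) + 15 / (n : ℝ)) Filter.atTop
      (nhds (1 / 4 + Real.exp (-1))) := by
    simpa using (tendsto_const_div_atTop_nhds_zero_nat (15 : ℝ)).const_add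
      (1 / 4 + Real.exp (-1))
  have hbelow : Filter.IsBoundedUnder (· ≥ ·) Filter.atTop
      fun n : ℕ => (n : ℝ) * minimaxRisk n :=
    Filter.isBoundedUnder_of ⟨0, fun n => mul_nonneg (Nat.cast_nonneg n) (minimaxRisk_nonneg n)⟩
  have habove : Filter.IsBoundedUnder (· ≤ ·) Filter.atTop
      fun n : ℕ => (n : ℝ) * minimaxRisk n :=
    htend.isBoundedUnder_le.mono_le hupper
  refine ⟨le_of_forall_lt fun y hy => ?_, ?_⟩
  · obtain ⟨z, hyz, hz⟩ := exists_between hy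
    exact hyz.trans_le (Filter.le_liminf_of_le habove.isCoboundedUnder_ge
      (eventually_le_mul_minimaxRisk hz))
  · rw [← htend.limsup_eq]
    exact Filter.limsup_le_limsup hupper hbelow.isCoboundedUnder_le htend.isBoundedUnder_le
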